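/- arXiv:1111.5658 — 2 statements merged into one kernel-verified Lean document; each statement's English description precedes it below -/
import Mathlib

section
/- Let p be stable of degree (n,m) and a_0,…,a_{m−1} the coefficient polynomials of L. Then ⟨z^{j₁+n} w^{k₁}, z^{j₂} a_{k₂}⟩ = 0 in L²(dσ/|p|²) whenever (j₁,k₁) ≠ (j₂,k₂), for all j₁,j₂ ∈ ℤ and 0 ≤ k₁,k₂ < m. -/
open Complex MeasureTheory Finset
open scoped ComplexInnerProductSpace

noncomputable section

/-- Evaluation of a bivariate polynomial with coefficient array `c i j`,
supported on `0 ≤ i ≤ n`, `0 ≤ j ≤ m`. -/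
def evalP (n m : ℕ) (c : ℕ → ℕ → ℂ) (z w : ℂ) : ℂ :=
  ∑ i ∈ Finset.range (n + 1), ∑ j ∈ Finset.range (m + 1), c i j * z ^ i * w ^ j

/-- `p` is stable: nonvanishing on the closed bidisk. -/
def Stable (n m : ℕ) (c : ℕ → ℕ → ℂ) : Prop :=
  ∀ z w : ℂ, ‖z‖ ≤ 1 → ‖w‖ ≤ 1 → evalP n m c z w ≠ 0

/-- `p` has degree exactly `n` in `z` and `m` in `w`. -/
def DegreeNM (n m : ℕ) (c : ℕ → ℕ → ℂ) : Prop :=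
  (∃ j, c n j ≠ 0) ∧ (∃ i, c i m ≠ 0)

/-- Coefficients of the reflected polynomial `p̃(z,w) = zⁿ wᵐ conj (p (1/z̄, 1/w̄))`. -/
def reflC (n m : ℕ) (c : ℕ → ℕ → ℂ) : ℕ → ℕ → ℂ :=
  fun i j => star (c (n - i) (m - j))

/-- The Laurent monomial `z^i w^j` as a function on the torus, `z = e^{iθ}`, `w = e^{iφ}`. -/
def tmono (i j : ℤ) : ℝ → ℝ → ℂ :=
  fun θ φ => Complex.exp (((i : ℂ) * (θ : ℂ) + (j : ℂ) * (φ : ℂ)) * Complex.I)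

/-- A bivariate polynomial as a function on the torus. -/
def onT (n m : ℕ) (c : ℕ → ℕ → ℂ) : ℝ → ℝ → ℂ :=
  fun θ φ => evalP n m c (Complex.exp ((θ : ℂ) * Complex.I)) (Complex.exp ((φ : ℂ) * Complex.I))

/-- The inner product `⟨f,g⟩ = ∫_{𝕋²} f ḡ dσ/|p|²` of `L²(dσ/|p|²)`. -/
def ip (n m : ℕ) (c : ℕ → ℕ → ℂ) (f g : ℝ → ℝ → ℂ) : ℂ :=
  (1 / (2 * Real.pi) ^ 2 : ℂ) *
    ∫ θ in (0 : ℝ)..(2 * Real.pi), ∫ φ in (0 : ℝ)..(2 * Real.pi),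
      f θ φ * star (g θ φ) / ((Complex.normSq (onT n m c θ φ) : ℝ) : ℂ)

/-- Numerator of the Christoffel–Darboux-type kernel `L`:
`zⁿ (p(z,w) conj(p(1/z̄,η)) − p̃(z,w) conj(p̃(1/z̄,η)))`. -/
def Lnum (n m : ℕ) (c : ℕ → ℕ → ℂ) (z w η : ℂ) : ℂ :=
  z ^ n * (evalP n m c z w * star (evalP n m c (star z)⁻¹ η)
    - evalP n m (reflC n m c) z w * star (evalP n m (reflC n m c) (star z)⁻¹ η))

/-- The kernel built from coefficient arrays `a k` for the polynomials `a_k(z,w)`: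
`L(z,w;η) = Σ_{k<m} a_k(z,w) η̄^k`. -/
def Lsum (n m : ℕ) (a : ℕ → ℕ → ℕ → ℂ) (z w η : ℂ) : ℂ :=
  ∑ k ∈ Finset.range m, evalP (2 * n) (m - 1) (a k) z w * (star η) ^ k

/-- `a` is the coefficient array of the kernel `L` associated with `p`:
`(1 - w η̄) L(z,w;η) = Lnum(z,w;η)` for all `z ≠ 0`. -/
def IsLCoeff (n m : ℕ) (c : ℕ → ℕ → ℂ) (a : ℕ → ℕ → ℕ → ℂ) : Prop :=
  ∀ z w η : ℂ, z ≠ 0 → (1 - w * star η) * Lsum n m a z w η = Lnum n m c z w η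

end

/-- The coefficient of `w^j` of `p(z,·)`. -/
noncomputable def colP (n : ℕ) (c : ℕ → ℕ → ℂ) (z : ℂ) (j : ℕ) : ℂ :=
  ∑ i ∈ Finset.range (n + 1), c i j * z ^ i

theorem evalP_eq_col (n m : ℕ) (c : ℕ → ℕ → ℂ) (z w : ℂ) :
    evalP n m c z w = ∑ j ∈ Finset.range (m + 1), colP n c z j * w ^ j := by
  unfold evalP colP
  rw [Finset.sum_comm]
  simp only [Finset.sum_mul]

theorem colP_refl (n m : ℕ) (c : ℕ → ℕ → ℂ) (z : ℂ) (hz0 : z ≠ 0) (hz : star z = z⁻¹) (j : ℕ) :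
    colP n (reflC n m c) z j = z ^ n * star (colP n c z (m - j)) := by
  unfold colP reflC
  rw [← Finset.sum_range_reflect, star_sum, Finset.mul_sum]
  refine Finset.sum_congr rfl fun i hi => ?_
  have hi' : i ≤ n := by simpa [Nat.lt_succ_iff] using hi
  have e1 : n + 1 - 1 - i = n - i := by omega
  have e2 : n - (n - i) = i := by omega
  rw [e1, e2, star_mul', star_pow, hz]
  have : z ^ n = z ^ (n - i) * z ^ i := by rw [← pow_add]; congr 1; omega
  rw [this, inv_pow]
  field_simp

theorem evalP_refl (n m : ℕ) (c : ℕ → ℕ → ℂ) (z w : ℂ) (hz0 : z ≠ 0) (hz : star z = z⁻¹)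
    (hw0 : w ≠ 0) (hw : star w = w⁻¹) :
    evalP n m (reflC n m c) z w = z ^ n * (w ^ m * star (evalP n m c z w)) := by
  rw [evalP_eq_col, evalP_eq_col, ← Finset.sum_range_reflect, star_sum, Finset.mul_sum,
    Finset.mul_sum]
  refine Finset.sum_congr rfl fun i hi => ?_
  have hi' : i ≤ m := by simpa [Nat.lt_succ_iff] using hi
  have e1 : m + 1 - 1 - i = m - i := by omega
  have e2 : m - (m - i) = i := by omega
  rw [colP_refl n m c z hz0 hz, e1, e2, star_mul', star_pow, hw]
  have : w ^ m = w ^ (m - i) * w ^ i := by rw [← pow_add]; congr 1; omega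
  rw [this, inv_pow]
  field_simp

theorem recur_solve (w : ℂ) (A r : ℕ → ℂ) (m : ℕ)
    (h : ∀ t : ℂ, (1 - w * t) * ∑ k ∈ Finset.range m, A k * t ^ k
      = ∑ k ∈ Finset.range (m + 1), r k * t ^ k) (k : ℕ) (hk : k < m) :
    A k = ∑ l ∈ Finset.range (k + 1), w ^ (k - l) * r l := by
  have hp : (1 - Polynomial.C w * Polynomial.X) *
      (∑ k ∈ Finset.range m, Polynomial.C (A k) * Polynomial.X ^ k)
      = ∑ k ∈ Finset.range (m + 1), Polynomial.C (r k) * Polynomial.X ^ k := by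
    apply Polynomial.funext
    intro t
    simpa [Polynomial.eval_finsetSum] using h t
  have hq : ∀ k, (∑ k ∈ Finset.range m, Polynomial.C (A k) * Polynomial.X ^ k).coeff k
      = if k < m then A k else 0 := by
    intro k
    simp [Polynomial.coeff_X_pow]
  have hr : ∀ k, (∑ k ∈ Finset.range (m + 1), Polynomial.C (r k) * Polynomial.X ^ k).coeff k
      = if k < m + 1 then r k else 0 := by
    intro k
    simp [Polynomial.coeff_X_pow]
  induction k with
  | zero =>
    have := congrArg (fun q => Polynomial.coeff q 0) hp
    simp only [hr] at this
    rw [sub_mul, one_mul, mul_assoc, Polynomial.coeff_sub, Polynomial.coeff_C_mul, hq,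
      Polynomial.coeff_X_mul_zero] at this
    simpa [hk] using this
  | succ k ih =>
    have := congrArg (fun q => Polynomial.coeff q (k + 1)) hp
    simp only [hr] at this
    rw [sub_mul, one_mul, mul_assoc, Polynomial.coeff_sub, Polynomial.coeff_C_mul, hq,
      Polynomial.coeff_X_mul, hq, if_pos hk, if_pos (by omega), if_pos (by omega)] at this
    rw [Finset.sum_range_succ, sub_eq_iff_eq_add.mp this, ih (by omega), Finset.mul_sum, add_comm]
    congr 1
    · refine Finset.sum_congr rfl fun l hl => ?_
      have : k + 1 - l = (k - l) + 1 := by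
        have := Finset.mem_range.mp hl; omega
      rw [this]; ring
    · simp

theorem a_formula (n m : ℕ) (c : ℕ → ℕ → ℂ) (a : ℕ → ℕ → ℕ → ℂ) (ha : IsLCoeff n m c a)
    (z w : ℂ) (hz0 : z ≠ 0) (hz : star z = z⁻¹) (hw0 : w ≠ 0) (hw : star w = w⁻¹)
    (k : ℕ) (hk : k < m) :
    evalP (2 * n) (m - 1) (a k) z w = ∑ l ∈ Finset.range (k + 1), w ^ (k - l) *
      (z ^ n * (evalP n m c z w * star (colP n c z l)
        - w ^ m * star (evalP n m c z w) * colP n c z (m - l))) := by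
  refine recur_solve w (fun k => evalP (2 * n) (m - 1) (a k) z w) _ m (fun t => ?_) k hk
  have h := ha z w (star t) hz0
  unfold Lsum Lnum at h
  rw [star_star] at h
  rw [h, evalP_refl n m c z w hz0 hz hw0 hw, hz, inv_inv, evalP_eq_col n m _ z (star t),
    evalP_eq_col n m _ z (star t), star_sum, star_sum, Finset.mul_sum, Finset.mul_sum,
    ← Finset.sum_sub_distrib, Finset.mul_sum]
  refine Finset.sum_congr rfl fun l _ => ?_
  rw [colP_refl n m c z hz0 hz]
  simp only [star_mul', star_pow, star_star, hz, inv_pow]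
  field_simp

theorem pointwise (n m : ℕ) (c : ℕ → ℕ → ℂ) (a : ℕ → ℕ → ℕ → ℂ) (ha : IsLCoeff n m c a)
    (z w : ℂ) (hz0 : z ≠ 0) (hz : star z = z⁻¹) (hw0 : w ≠ 0) (hw : star w = w⁻¹)
    (hP : evalP n m c z w ≠ 0)
    (k₁ k : ℕ) (hk₁ : k₁ < m) (hk : k < m) :
    z ^ n * w ^ k₁ * star (evalP (2 * n) (m - 1) (a k) z w) /
      (evalP n m c z w * star (evalP n m c z w)) =
    w ^ ((k₁ : ℤ) - k)
      - ∑ l ∈ Finset.Ico (k + 1) (m + 1), colP n c z l * (w ^ (k₁ + l - k) / evalP n m c z w)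
      - ∑ l ∈ Finset.range (k + 1),
          star (colP n c z (m - l)) * star (w ^ (m - l + k - k₁) / evalP n m c z w) := by
  have hsP : star (evalP n m c z w) ≠ 0 := star_ne_zero.mpr hP
  have hsum : w ^ ((k₁ : ℤ) - k) = ∑ l ∈ Finset.range (m + 1),
      colP n c z l * w ^ l * w ^ ((k₁ : ℤ) - k) / evalP n m c z w := by
    rw [← Finset.sum_div, ← Finset.sum_mul, ← evalP_eq_col]
    field_simp
  rw [hsum, ← Finset.sum_range_add_sum_Ico _ (show k + 1 ≤ m + 1 by omega)]
  have h2 : ∑ l ∈ Finset.Ico (k + 1) (m + 1),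
      colP n c z l * w ^ l * w ^ ((k₁ : ℤ) - k) / evalP n m c z w
      = ∑ l ∈ Finset.Ico (k + 1) (m + 1), colP n c z l * (w ^ (k₁ + l - k) / evalP n m c z w) := by
    refine Finset.sum_congr rfl fun l hl => ?_
    have hl := Finset.mem_Ico.mp hl
    have : w ^ (k₁ + l - k) = w ^ l * w ^ ((k₁ : ℤ) - k) := by
      rw [← zpow_natCast, ← zpow_natCast, ← zpow_add₀ hw0]; congr 1; omega
    rw [this]; ring
  rw [h2, add_sub_cancel_right, ← Finset.sum_sub_distrib,
    a_formula n m c a ha z w hz0 hz hw0 hw k hk, star_sum, Finset.mul_sum, Finset.sum_div]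
  refine Finset.sum_congr rfl fun l hl => ?_
  have hl : l ≤ k := by simpa [Nat.lt_succ_iff] using hl
  simp only [star_mul', star_pow, star_sub, star_star, star_div₀, hz, hw]
  have e1 : w ^ k = w ^ (k - l) * w ^ l := by rw [← pow_add]; congr 1; omega
  have e2 : w ^ (m - l + k - k₁) * w ^ k₁ = w ^ m * w ^ (k - l) := by
    rw [← pow_add, ← pow_add]; congr 1; omega
  have e3 : (w⁻¹) ^ (m - l + k - k₁) = w ^ k₁ / (w ^ m * w ^ (k - l)) := by
    rw [← e2, inv_pow]; field_simp
  rw [e3, zpow_sub₀ hw0, zpow_natCast, zpow_natCast, e1]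
  generalize star (evalP n m c z w) = Q at *
  generalize evalP n m c z w = P at *
  generalize star (colP n c z (m - l)) = u at *
  generalize colP n c z l = v at *
  simp only [inv_pow]
  field_simp

theorem int_zero (n m : ℕ) (c : ℕ → ℕ → ℂ) (hst : Stable n m c) (z : ℂ) (hz : ‖z‖ ≤ 1)
    (s : ℕ) (hs : 0 < s) :
    ∫ φ in (0 : ℝ)..(2 * Real.pi), (Complex.exp ((φ : ℂ) * Complex.I)) ^ s /
      evalP n m c z (Complex.exp ((φ : ℂ) * Complex.I)) = 0 := by
  have hd : ∀ w : ℂ, ‖w‖ ≤ 1 → DifferentiableAt ℂ (fun w => w ^ (s - 1) / evalP n m c z w) w := by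
    intro w hw
    refine DifferentiableAt.div (by fun_prop) ?_ (hst z w hz hw)
    unfold evalP
    fun_prop
  have h := Complex.circleIntegral_eq_zero_of_differentiable_on_off_countable (R := 1) zero_le_one
    (c := 0) (f := fun w => w ^ (s - 1) / evalP n m c z w) Set.countable_empty
    (fun w hw => (hd w (by simpa using hw)).continuousAt.continuousWithinAt)
    (fun w hw => hd w (by simpa using (Metric.ball_subset_closedBall hw.1)))
  rw [circleIntegral] at h
  have h2 : ∀ φ : ℝ, deriv (circleMap 0 1) φ • ((circleMap 0 1 φ) ^ (s - 1) /
      evalP n m c z (circleMap 0 1 φ)) = Complex.I * ((Complex.exp ((φ : ℂ) * Complex.I)) ^ s /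
      evalP n m c z (Complex.exp ((φ : ℂ) * Complex.I))) := by
    intro φ
    obtain ⟨s, rfl⟩ : ∃ t, s = t + 1 := ⟨s - 1, by omega⟩
    simp [circleMap]
    ring
  simp only [h2] at h
  rw [intervalIntegral.integral_const_mul] at h
  exact (mul_eq_zero.mp h).resolve_left Complex.I_ne_zero

theorem int_zpow (s : ℤ) (hs : s ≠ 0) :
    ∫ φ in (0 : ℝ)..(2 * Real.pi), (Complex.exp ((φ : ℂ) * Complex.I)) ^ s = 0 := by
  have h : ∀ φ : ℝ, (Complex.exp ((φ : ℂ) * Complex.I)) ^ s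
      = Complex.exp (((s : ℂ) * Complex.I) * φ) := by
    intro φ
    rw [← Complex.exp_int_mul]; congr 1; ring
  simp only [h]
  rw [integral_exp_mul_complex (by simp [hs])]
  have : Complex.exp ((s : ℂ) * Complex.I * ((2 * Real.pi : ℝ) : ℂ)) = 1 := by
    rw [Complex.exp_eq_one_iff]
    exact ⟨s, by push_cast; ring⟩
  rw [this]; simp

theorem star_expI (θ : ℝ) : star (Complex.exp ((θ : ℂ) * Complex.I))
    = (Complex.exp ((θ : ℂ) * Complex.I))⁻¹ := by
  rw [← Complex.exp_neg, Complex.star_def, ← Complex.exp_conj]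
  simp

theorem inner_int (n m : ℕ) (c : ℕ → ℕ → ℂ) (hst : Stable n m c)
    (a : ℕ → ℕ → ℕ → ℂ) (ha : IsLCoeff n m c a) (z : ℂ) (hz0 : z ≠ 0) (hz : star z = z⁻¹)
    (hzn : ‖z‖ = 1) (k₁ k : ℕ) (hk₁ : k₁ < m) (hk : k < m) :
    ∫ φ in (0 : ℝ)..(2 * Real.pi), (z ^ n * (Complex.exp ((φ : ℂ) * Complex.I)) ^ k₁ *
      star (evalP (2 * n) (m - 1) (a k) z (Complex.exp ((φ : ℂ) * Complex.I))) /
      (evalP n m c z (Complex.exp ((φ : ℂ) * Complex.I)) *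
        star (evalP n m c z (Complex.exp ((φ : ℂ) * Complex.I)))))
    = ∫ φ in (0 : ℝ)..(2 * Real.pi), (Complex.exp ((φ : ℂ) * Complex.I)) ^ ((k₁ : ℤ) - k) := by
  have hne : ∀ φ : ℝ, evalP n m c z (Complex.exp ((φ : ℂ) * Complex.I)) ≠ 0 := fun φ =>
    hst z _ hzn.le (Complex.norm_exp_ofReal_mul_I φ).le
  have hpt := fun φ : ℝ => pointwise n m c a ha z _ hz0 hz (Complex.exp_ne_zero _) (star_expI φ)
    (hne φ) k₁ k hk₁ hk
  simp only [hpt]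
  have hcP : Continuous fun φ : ℝ => evalP n m c z (Complex.exp ((φ : ℂ) * Complex.I)) := by
    unfold evalP; fun_prop
  have hcq : ∀ s : ℕ, Continuous fun φ : ℝ => (Complex.exp ((φ : ℂ) * Complex.I)) ^ s /
      evalP n m c z (Complex.exp ((φ : ℂ) * Complex.I)) := fun s =>
    Continuous.div (by fun_prop) hcP hne
  have hcz : Continuous fun φ : ℝ => (Complex.exp ((φ : ℂ) * Complex.I)) ^ ((k₁ : ℤ) - k) :=
    Continuous.zpow₀ (by fun_prop) _ (fun φ => Or.inl (Complex.exp_ne_zero _))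
  have hc1 : ∀ l, Continuous fun φ : ℝ => colP n c z l *
      ((Complex.exp ((φ : ℂ) * Complex.I)) ^ (k₁ + l - k) /
      evalP n m c z (Complex.exp ((φ : ℂ) * Complex.I))) := fun l => continuous_const.mul (hcq _)
  have hc2 : ∀ l, Continuous fun φ : ℝ => star (colP n c z (m - l)) *
      star ((Complex.exp ((φ : ℂ) * Complex.I)) ^ (m - l + k - k₁) /
      evalP n m c z (Complex.exp ((φ : ℂ) * Complex.I))) := fun l =>
    continuous_const.mul (hcq _).star
  have hs1 := continuous_finsetSum (Finset.Ico (k + 1) (m + 1)) (fun l _ => hc1 l)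
  have hs2 := continuous_finsetSum (Finset.range (k + 1)) (fun l _ => hc2 l)
  have hcs : Continuous fun φ : ℝ => (Complex.exp ((φ : ℂ) * Complex.I)) ^ ((k₁ : ℤ) - k)
      - ∑ l ∈ Finset.Ico (k + 1) (m + 1), colP n c z l *
        ((Complex.exp ((φ : ℂ) * Complex.I)) ^ (k₁ + l - k) /
          evalP n m c z (Complex.exp ((φ : ℂ) * Complex.I))) := hcz.sub hs1
  rw [intervalIntegral.integral_sub (hcs.intervalIntegrable _ _)
      (hs2.intervalIntegrable _ _),
    intervalIntegral.integral_sub (hcz.intervalIntegrable _ _) (hs1.intervalIntegrable _ _),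
    intervalIntegral.integral_finsetSum (fun l _ => (hc1 l).intervalIntegrable _ _),
    intervalIntegral.integral_finsetSum (fun l _ => (hc2 l).intervalIntegrable _ _),
    Finset.sum_eq_zero, Finset.sum_eq_zero, sub_zero, sub_zero]
  · intro l hl
    have hl : l ≤ k := by simpa [Nat.lt_succ_iff] using hl
    rw [intervalIntegral.integral_const_mul]
    have h := int_zero n m c hst z hzn.le (m - l + k - k₁) (by omega)
    have h2 : ∫ φ in (0 : ℝ)..(2 * Real.pi), star ((Complex.exp ((φ : ℂ) * Complex.I)) ^
        (m - l + k - k₁) / evalP n m c z (Complex.exp ((φ : ℂ) * Complex.I))) = star (0 : ℂ) := by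
      rw [← h]
      rw [intervalIntegral.integral_of_le (by positivity),
        intervalIntegral.integral_of_le (by positivity)]
      exact integral_conj
    rw [h2, star_zero, mul_zero]
  · intro l hl
    have hl := Finset.mem_Ico.mp hl
    rw [intervalIntegral.integral_const_mul, int_zero n m c hst z hzn.le _ (by omega), mul_zero]

/-- ⟨z^{j₁+n} w^{k₁}, z^{j₂} a_{k₂}⟩ = 0 whenever (j₁,k₁) ≠ (j₂,k₂). -/
theorem statement10 (n m : ℕ) (c : ℕ → ℕ → ℂ)
    (hstable : Stable n m c) (hdeg : DegreeNM n m c)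
    (a : ℕ → ℕ → ℕ → ℂ) (ha : IsLCoeff n m c a)
    (j₁ j₂ : ℤ) (k₁ k₂ : ℕ) (hk₁ : k₁ < m) (hk₂ : k₂ < m)
    (hne : ¬(j₁ = j₂ ∧ k₁ = k₂)) :
    ip n m c (tmono (j₁ + (n : ℤ)) (k₁ : ℤ))
      (fun θ φ => tmono j₂ 0 θ φ * onT (2 * n) (m - 1) (a k₂) θ φ) = 0 := by
  unfold ip
  have hinner : ∀ θ : ℝ, ∫ φ in (0 : ℝ)..(2 * Real.pi),
      tmono (j₁ + (n : ℤ)) (k₁ : ℤ) θ φ *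
        star (tmono j₂ 0 θ φ * onT (2 * n) (m - 1) (a k₂) θ φ) /
        ((Complex.normSq (onT n m c θ φ) : ℝ) : ℂ)
      = (Complex.exp ((θ : ℂ) * Complex.I)) ^ (j₁ - j₂) *
        ∫ φ in (0 : ℝ)..(2 * Real.pi), (Complex.exp ((φ : ℂ) * Complex.I)) ^ ((k₁ : ℤ) - k₂) := by
    intro θ
    rw [← inner_int n m c hstable a ha (Complex.exp ((θ : ℂ) * Complex.I)) (Complex.exp_ne_zero _)
      (star_expI θ) (Complex.norm_exp_ofReal_mul_I θ) k₁ k₂ hk₁ hk₂,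
      ← intervalIntegral.integral_const_mul]
    congr 1
    funext φ
    have t1 : ∀ i j : ℤ, tmono i j θ φ = (Complex.exp ((θ : ℂ) * Complex.I)) ^ i *
        (Complex.exp ((φ : ℂ) * Complex.I)) ^ j := by
      intro i j
      unfold tmono
      rw [← Complex.exp_int_mul, ← Complex.exp_int_mul, ← Complex.exp_add]
      congr 1; ring
    rw [t1, t1, ← Complex.mul_conj, zpow_zero, mul_one, star_mul', star_zpow₀, star_expI,
      zpow_add₀ (Complex.exp_ne_zero _), zpow_sub₀ (Complex.exp_ne_zero _), inv_zpow,
      zpow_natCast, zpow_natCast]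
    simp only [onT, Complex.star_def]
    ring
  simp only [hinner]
  rw [intervalIntegral.integral_mul_const]
  by_cases hk : k₁ = k₂
  · have hj : j₁ - j₂ ≠ 0 := fun h => hne ⟨by omega, hk⟩
    rw [int_zpow _ hj]; simp
  · rw [int_zpow ((k₁ : ℤ) - k₂) (by omega)]; simp
end

section
/- Let p be stable of degree (n,m). In L²(dσ/|p|²), the closed span of {z^i a_j : i ≥ 0, 0 ≤ j < m} equals the orthogonal complement of span{z^i w^j : 0 ≤ i < n, 0 ≤ j < m} inside the closed span of {z^i w^j : i ≥ 0, 0 ≤ j < m}, and moreover this space is orthogonal to the closed span of {z^i w^j : i < n, j ≥ 0}. -/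
open Complex MeasureTheory Finset
open scoped ComplexInnerProductSpace

noncomputable section

/-- The measure `dμ = dσ/|p|²` on the torus, realized on the parameter square
`[0,2π]²` with normalized Lebesgue measure. -/
def muT (n m : ℕ) (c : ℕ → ℕ → ℂ) : Measure (ℝ × ℝ) :=
  ((volume : Measure (ℝ × ℝ)).restrict
      (Set.Icc 0 (2 * Real.pi) ×ˢ Set.Icc 0 (2 * Real.pi))).withDensity
    fun x => ENNReal.ofReal
      (1 / ((2 * Real.pi) ^ 2 * Complex.normSq (onT n m c x.1 x.2)))

end

lemma aux_cauchy (h : ℂ → ℂ) (hd : ∀ z, ‖z‖ ≤ 1 → DifferentiableAt ℂ h z) (l : ℤ) (hl : 0 < l) :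
    ∫ φ in Set.Icc (0:ℝ) (2 * Real.pi),
      Complex.exp ((l : ℂ) * (φ : ℂ) * Complex.I) * h (Complex.exp ((φ : ℂ) * Complex.I)) = 0 := by
  obtain ⟨k, rfl⟩ : ∃ k : ℕ, l = k + 1 := ⟨(l - 1).toNat, by omega⟩
  have hdiff : DifferentiableOn ℂ (fun w => w ^ k * h w) (Metric.closedBall 0 1) := by
    intro z hz
    have hz' : ‖z‖ ≤ 1 := by simpa using hz
    exact ((differentiableAt_pow k).mul (hd z hz')).differentiableWithinAt
  have hc : (∮ w in C(0, 1), w ^ k * h w) = 0 := by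
    apply DiffContOnCl.circleIntegral_eq_zero zero_le_one
    apply DifferentiableOn.diffContOnCl
    rwa [closure_ball _ one_ne_zero]
  rw [circleIntegral, intervalIntegral.integral_of_le (by positivity)] at hc
  rw [integral_Icc_eq_integral_Ioc]
  have h2 : ∀ φ : ℝ, deriv (circleMap 0 1) φ • ((circleMap 0 1 φ) ^ k * h (circleMap 0 1 φ))
      = Complex.I * (Complex.exp ((((k : ℤ) + 1 : ℤ) : ℂ) * (φ : ℂ) * Complex.I) *
        h (Complex.exp ((φ : ℂ) * Complex.I))) := by
    intro φ
    have : Complex.exp ((((k : ℤ) + 1 : ℤ) : ℂ) * (φ : ℂ) * Complex.I)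
        = Complex.exp ((φ : ℂ) * Complex.I) ^ (k + 1) := by
      rw [← Complex.exp_nat_mul]; congr 1; push_cast; ring
    rw [this, deriv_circleMap]
    simp only [circleMap, smul_eq_mul, zero_add, ofReal_one, one_mul]
    ring
  simp only [h2] at hc
  rw [integral_const_mul] at hc
  exact (mul_eq_zero.mp hc).resolve_left Complex.I_ne_zero

/-- The square. -/
def auxS : Set (ℝ × ℝ) := Set.Icc 0 (2 * Real.pi) ×ˢ Set.Icc 0 (2 * Real.pi)

lemma aux_compact : IsCompact auxS := isCompact_Icc.prod isCompact_Icc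

lemma aux_meas : MeasurableSet auxS := measurableSet_Icc.prod measurableSet_Icc

lemma aux_fub (F : ℝ × ℝ → ℂ) (hF : Continuous F) :
    ∫ x in auxS, F x = ∫ θ in Set.Icc (0:ℝ) (2 * Real.pi), ∫ φ in Set.Icc (0:ℝ) (2 * Real.pi),
      F (θ, φ) := by
  unfold auxS
  rw [Measure.volume_eq_prod]
  exact setIntegral_prod _ (hF.continuousOn.integrableOn_compact aux_compact)

lemma aux_fub' (F : ℝ × ℝ → ℂ) (hF : Continuous F) :
    ∫ x in auxS, F x = ∫ φ in Set.Icc (0:ℝ) (2 * Real.pi), ∫ θ in Set.Icc (0:ℝ) (2 * Real.pi),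
      F (θ, φ) := by
  unfold auxS
  have := (hF.continuousOn (s := auxS)).integrableOn_compact (μ := volume) aux_compact
  rw [Measure.volume_eq_prod, ← Measure.prod_restrict]
  apply integral_prod_symm
  rw [Measure.prod_restrict]
  exact this

lemma aux_evalP_cont (n m : ℕ) (c : ℕ → ℕ → ℂ) : Continuous fun x : ℂ × ℂ => evalP n m c x.1 x.2 := by
  unfold evalP; fun_prop

lemma aux_onT_cont (n m : ℕ) (c : ℕ → ℕ → ℂ) :
    Continuous fun x : ℝ × ℝ => onT n m c x.1 x.2 := by
  unfold onT evalP; fun_prop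

lemma aux_tmono_cont (i j : ℤ) : Continuous fun x : ℝ × ℝ => tmono i j x.1 x.2 := by
  unfold tmono; fun_prop

lemma aux_tmono_mul (i j i' j' : ℤ) (θ φ : ℝ) :
    tmono i j θ φ * tmono i' j' θ φ = tmono (i + i') (j + j') θ φ := by
  unfold tmono; rw [← Complex.exp_add]; congr 1; push_cast; ring

lemma aux_tmono_star (i j : ℤ) (θ φ : ℝ) :
    star (tmono i j θ φ) = tmono (-i) (-j) θ φ := by
  unfold tmono
  rw [Complex.star_def, ← Complex.exp_conj]; congr 1
  simp
  ring

lemma aux_tmono_split (i j : ℤ) (θ φ : ℝ) : tmono i j θ φ =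
    Complex.exp ((i : ℂ) * (θ : ℂ) * Complex.I) * Complex.exp ((j : ℂ) * (φ : ℂ) * Complex.I) := by
  unfold tmono; rw [← Complex.exp_add]; congr 1; ring

lemma aux_tmono_eq (i j : ℤ) (θ φ : ℝ) : tmono i j θ φ =
    Complex.exp ((θ : ℂ) * Complex.I) ^ i * Complex.exp ((φ : ℂ) * Complex.I) ^ j := by
  rw [aux_tmono_split, ← Complex.exp_int_mul, ← Complex.exp_int_mul]
  congr 2 <;> ring

lemma aux_norm_exp (θ : ℝ) : ‖Complex.exp ((θ : ℂ) * Complex.I)‖ = 1 :=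
  Complex.norm_exp_ofReal_mul_I θ

lemma aux_onT_ne {n m : ℕ} {c : ℕ → ℕ → ℂ} (h : Stable n m c) (θ φ : ℝ) : onT n m c θ φ ≠ 0 :=
  h _ _ (aux_norm_exp θ).le (aux_norm_exp φ).le

lemma aux_quot_cont {n m : ℕ} {c : ℕ → ℕ → ℂ} (h : Stable n m c) (k l : ℤ) :
    Continuous fun x : ℝ × ℝ => tmono k l x.1 x.2 / onT n m c x.1 x.2 :=
  (aux_tmono_cont k l).div (aux_onT_cont n m c) fun _ => aux_onT_ne h _ _

lemma aux_int_w {n m : ℕ} {c : ℕ → ℕ → ℂ} (h : Stable n m c) (k l : ℤ) (hl : 0 < l) :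
    ∫ x in auxS, tmono k l x.1 x.2 / onT n m c x.1 x.2 = 0 := by
  rw [aux_fub _ (aux_quot_cont h k l)]
  rw [← integral_zero ℝ ℂ (μ := volume.restrict (Set.Icc (0:ℝ) (2 * Real.pi)))]
  congr 1
  funext θ
  have := aux_cauchy (fun w => Complex.exp ((k : ℂ) * (θ : ℂ) * Complex.I) /
    evalP n m c (Complex.exp ((θ : ℂ) * Complex.I)) w) (by
      intro w hw
      apply DifferentiableAt.div (differentiableAt_const _)
      · unfold evalP; fun_prop
      · exact h _ _ (aux_norm_exp θ).le hw) l hl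
  rw [← this]
  congr 1
  funext φ
  rw [aux_tmono_split]
  simp only [onT]
  ring

lemma aux_int_z {n m : ℕ} {c : ℕ → ℕ → ℂ} (h : Stable n m c) (k l : ℤ) (hk : 0 < k) :
    ∫ x in auxS, tmono k l x.1 x.2 / onT n m c x.1 x.2 = 0 := by
  rw [aux_fub' _ (aux_quot_cont h k l)]
  rw [← integral_zero ℝ ℂ (μ := volume.restrict (Set.Icc (0:ℝ) (2 * Real.pi)))]
  congr 1
  funext φ
  have := aux_cauchy (fun z => Complex.exp ((l : ℂ) * (φ : ℂ) * Complex.I) /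
    evalP n m c z (Complex.exp ((φ : ℂ) * Complex.I))) (by
      intro w hw
      apply DifferentiableAt.div (differentiableAt_const _)
      · unfold evalP; fun_prop
      · exact h _ _ hw (aux_norm_exp φ).le) k hk
  rw [← this]
  congr 1
  funext θ
  rw [aux_tmono_split]
  simp only [onT]
  ring

lemma aux_int_conj {n m : ℕ} {c : ℕ → ℕ → ℂ} (h : Stable n m c) (k l : ℤ) (hk : k < 0 ∨ l < 0) :
    ∫ x in auxS, tmono k l x.1 x.2 / star (onT n m c x.1 x.2) = 0 := by
  have h1 : ∫ x in auxS, tmono (-k) (-l) x.1 x.2 / onT n m c x.1 x.2 = 0 := by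
    rcases hk with hk | hk
    · exact aux_int_z h _ _ (by omega)
    · exact aux_int_w h _ _ (by omega)
  have h2 := congrArg (starRingEnd ℂ) h1
  rw [← integral_conj, map_zero] at h2
  rw [← h2]
  congr 1
  funext x
  rw [map_div₀, ← Complex.star_def, aux_tmono_star, neg_neg, neg_neg]

lemma aux_int_exp (k : ℤ) : ∫ φ in Set.Icc (0:ℝ) (2 * Real.pi),
    Complex.exp ((k : ℂ) * (φ : ℂ) * Complex.I) = if k = 0 then (2 * Real.pi : ℂ) else 0 := by
  split_ifs with hk
  · subst hk
    simp [Real.pi_pos.le]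
  · rcases lt_or_gt_of_ne hk with hk | hk
    · have := aux_cauchy (fun _ => 1) (fun _ _ => differentiableAt_const _) (-k) (by omega)
      have h2 := congrArg (starRingEnd ℂ) this
      rw [← integral_conj, map_zero] at h2
      rw [← h2]
      congr 1
      funext x
      rw [mul_one, ← Complex.exp_conj]
      simp
    · simpa using aux_cauchy (fun _ => 1) (fun _ _ => differentiableAt_const _) k hk

lemma aux_int_mono (k l : ℤ) : ∫ x in auxS, tmono k l x.1 x.2 =
    if k = 0 ∧ l = 0 then (2 * Real.pi : ℂ) ^ 2 else 0 := by
  rw [aux_fub _ (aux_tmono_cont k l)]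
  simp only [aux_tmono_split, integral_const_mul, integral_mul_const, aux_int_exp]
  by_cases hk : k = 0 <;> by_cases hl : l = 0 <;> simp [hk, hl, sq]

lemma aux_refl (n m : ℕ) (c : ℕ → ℕ → ℂ) (z w : ℂ) (hz : ‖z‖ = 1) (hw : ‖w‖ = 1) :
    evalP n m (reflC n m c) z w = z ^ n * w ^ m * star (evalP n m c z w) := by
  have key : ∀ z : ℂ, ‖z‖ = 1 → ∀ n i, i ≤ n → z ^ n * star z ^ (n - i) = z ^ i := by
    intro z hz n i hi
    have : z * star z = 1 := by
      rw [Complex.star_def, Complex.mul_conj, Complex.normSq_eq_norm_sq, hz]; simp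
    obtain ⟨d, rfl⟩ := Nat.exists_eq_add_of_le hi
    rw [Nat.add_sub_cancel_left, pow_add, mul_assoc, ← mul_pow, this, one_pow, mul_one]
  unfold evalP
  rw [star_sum, Finset.mul_sum, ← Finset.sum_range_reflect]
  apply Finset.sum_congr rfl
  intro i hi
  rw [star_sum, Finset.mul_sum, ← Finset.sum_range_reflect]
  apply Finset.sum_congr rfl
  intro j hj
  have hi' : i ≤ n := by simpa [Nat.lt_succ_iff] using hi
  have hj' : j ≤ m := by simpa [Nat.lt_succ_iff] using hj
  have e1 : n + 1 - 1 - i = n - i := by omega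
  have e2 : m + 1 - 1 - j = m - j := by omega
  have e3 : n - (n - i) = i := by omega
  have e4 : m - (m - j) = j := by omega
  have k1 := key z hz n (n - i) (by omega)
  have k2 := key w hw m (m - j) (by omega)
  rw [e3] at k1
  rw [e4] at k2
  simp only [reflC, e1, e2, e3, e4, star_mul', star_pow]
  rw [← k1, ← k2]
  ring

/-- Coefficient recursion. -/
lemma aux_coeff (m : ℕ) (A N : ℕ → ℂ) (w : ℂ)
    (h : ∀ x : ℂ, (1 - w * x) * ∑ k ∈ Finset.range m, A k * x ^ k
      = ∑ t ∈ Finset.range (m + 1), N t * x ^ t) :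
    ∀ j < m, A j = ∑ t ∈ Finset.range (j + 1), w ^ (j - t) * N t := by
  have hp : (1 - Polynomial.C w * Polynomial.X) *
      (∑ k ∈ Finset.range m, Polynomial.C (A k) * Polynomial.X ^ k)
      = ∑ t ∈ Finset.range (m + 1), Polynomial.C (N t) * Polynomial.X ^ t := by
    apply Polynomial.funext
    intro x
    simpa [Polynomial.eval_finsetSum] using h x
  have hc : ∀ j, Polynomial.coeff (∑ k ∈ Finset.range m, Polynomial.C (A k) * Polynomial.X ^ k) j
      = if j < m then A j else 0 := by
    intro j; simp [Polynomial.coeff_C_mul, Polynomial.coeff_X_pow]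
  have hc' : ∀ j, Polynomial.coeff (∑ t ∈ Finset.range (m + 1),
      Polynomial.C (N t) * Polynomial.X ^ t) j
      = if j < m + 1 then N j else 0 := by
    intro j; simp [Polynomial.coeff_C_mul, Polynomial.coeff_X_pow]
  rw [sub_mul, one_mul, mul_assoc] at hp
  intro j
  induction j with
  | zero =>
    intro hj
    have := congrArg (fun q => Polynomial.coeff q 0) hp
    simp only [Polynomial.coeff_sub, hc, hc', Polynomial.coeff_C_mul] at this
    simpa [hj] using this
  | succ j ih =>
    intro hj
    have h1 := ih (by omega)
    have := congrArg (fun q => Polynomial.coeff q (j + 1)) hp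
    simp only [Polynomial.coeff_sub, hc, hc', Polynomial.coeff_C_mul,
      Polynomial.coeff_X_mul] at this
    rw [if_pos hj, if_pos (by omega), if_pos (by omega)] at this
    rw [Finset.sum_range_succ, Nat.sub_self, pow_zero, one_mul, ← this, h1, Finset.mul_sum]
    have : ∀ t ∈ Finset.range (j + 1), w ^ (j + 1 - t) * N t = w * (w ^ (j - t) * N t) := by
      intro t ht
      have : j + 1 - t = (j - t) + 1 := by simp at ht; omega
      rw [this, pow_succ]; ring
    rw [Finset.sum_congr rfl this]; ring

/-- Coefficient polynomial of `w^t`. -/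
def auxCol (n : ℕ) (c : ℕ → ℕ → ℂ) (t : ℕ) (z : ℂ) : ℂ := ∑ s ∈ Finset.range (n + 1), c s t * z ^ s

lemma aux_evalP_col (n m : ℕ) (c : ℕ → ℕ → ℂ) (z w : ℂ) :
    evalP n m c z w = ∑ t ∈ Finset.range (m + 1), auxCol n c t z * w ^ t := by
  unfold evalP auxCol
  rw [Finset.sum_comm]
  simp only [Finset.sum_mul]

lemma aux_Aj {n m : ℕ} {c : ℕ → ℕ → ℂ} {a : ℕ → ℕ → ℕ → ℂ} (ha : IsLCoeff n m c a)
    (z w : ℂ) (hz : ‖z‖ = 1) (j : ℕ) (hj : j < m) :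
    evalP (2 * n) (m - 1) (a j) z w = ∑ t ∈ Finset.range (j + 1), w ^ (j - t) *
      (z ^ n * (evalP n m c z w * star (auxCol n c t z)
        - evalP n m (reflC n m c) z w * star (auxCol n (reflC n m c) t z))) := by
  have hz0 : z ≠ 0 := by rintro rfl; simp at hz
  have hzz : (star z)⁻¹ = z := by
    rw [inv_eq_iff_eq_inv, Complex.inv_def, Complex.normSq_eq_norm_sq, hz]; simp
  refine aux_coeff m (fun k => evalP (2 * n) (m - 1) (a k) z w) (fun t =>
      (z ^ n * (evalP n m c z w * star (auxCol n c t z)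
        - evalP n m (reflC n m c) z w * star (auxCol n (reflC n m c) t z)))) w ?_ j hj
  intro x
  have h := ha z w (star x) hz0
  rw [Lsum, Lnum, star_star, hzz, aux_evalP_col n m c z (star x),
    aux_evalP_col n m (reflC n m c) z (star x)] at h
  rw [h]
  simp only [star_sum, star_mul', star_pow, star_star, Finset.mul_sum, ← Finset.sum_sub_distrib]
  apply Finset.sum_congr rfl
  intro t _
  ring

lemma aux_point {n m : ℕ} {c : ℕ → ℕ → ℂ} (hs : Stable n m c)
    {a : ℕ → ℕ → ℕ → ℂ} (ha : IsLCoeff n m c a) (i j : ℕ) (hj : j < m) (k l : ℤ) (θ φ : ℝ) :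
    tmono k l θ φ * star (tmono (i : ℤ) 0 θ φ * onT (2 * n) (m - 1) (a j) θ φ) /
        ((Complex.normSq (onT n m c θ φ) : ℝ) : ℂ)
      = tmono (k - i - n) (l - j) θ φ
        - ∑ t ∈ Finset.Ico (j + 1) (m + 1), ∑ s ∈ Finset.range (n + 1),
            c s t * (tmono (k - i - n + s) (l - j + t) θ φ / onT n m c θ φ)
        - ∑ t ∈ Finset.range (j + 1), ∑ s ∈ Finset.range (n + 1), reflC n m c s t *
            (tmono (k - i - 2 * n + s) (l - j + t - m) θ φ / star (onT n m c θ φ)) := by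
  have hp := aux_onT_ne hs θ φ
  rw [← Complex.mul_conj, ← Complex.star_def]
  have hps : star (onT n m c θ φ) ≠ 0 := by simpa using hp
  simp only [aux_tmono_eq]
  unfold onT at *
  have hz := aux_norm_exp θ
  have hw := aux_norm_exp φ
  generalize Complex.exp ((θ : ℂ) * Complex.I) = z at *
  generalize Complex.exp ((φ : ℂ) * Complex.I) = w at *
  have hz0 : z ≠ 0 := by rintro rfl; simp at hz
  have hw0 : w ≠ 0 := by rintro rfl; simp at hw
  have hzs : star z = z⁻¹ := by
    rw [Complex.inv_def, Complex.normSq_eq_norm_sq, hz]; simp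
  have hws : star w = w⁻¹ := by
    rw [Complex.inv_def, Complex.normSq_eq_norm_sq, hw]; simp
  rw [aux_Aj ha z w hz j hj]
  have hrefl := aux_refl n m c z w hz hw
  have hsplit : ∑ t ∈ Finset.range (j + 1), auxCol n c t z * w ^ t = evalP n m c z w
      - ∑ t ∈ Finset.Ico (j + 1) (m + 1), auxCol n c t z * w ^ t := by
    rw [aux_evalP_col, eq_sub_iff_add_eq, Finset.sum_range_add_sum_Ico _ (by omega)]
  set p := evalP n m c z w with hpdef
  rw [hrefl]
  have hst : star (z ^ (i : ℤ) * w ^ (0 : ℤ) * ∑ t ∈ Finset.range (j + 1), w ^ (j - t) *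
      (z ^ n * (p * star (auxCol n c t z)
        - z ^ n * w ^ m * star p * star (auxCol n (reflC n m c) t z))))
      = z ^ (-(i : ℤ) - n) * w ^ (-(j : ℤ)) * (star p * (∑ t ∈ Finset.range (j + 1), auxCol n c t z * w ^ t)
        - z ^ (-(n : ℤ)) * w ^ (-(m : ℤ)) * p *
          ∑ t ∈ Finset.range (j + 1), auxCol n (reflC n m c) t z * w ^ t) := by
    simp only [Finset.mul_sum, star_sum, ← Finset.sum_sub_distrib]
    apply Finset.sum_congr rfl
    intro t ht
    have ht' : t ≤ j := by simp at ht; omega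
    obtain ⟨d, rfl⟩ := Nat.exists_eq_add_of_le ht'
    simp only [star_mul', star_sub, star_star, star_pow, hzs, hws, Nat.add_sub_cancel_left,
      zpow_sub₀ hz0, zpow_neg, zpow_natCast, zpow_zero, star_one]
    simp only [inv_pow, pow_add]
    field_simp
  rw [hst, hsplit]
  have e1 : ∑ t ∈ Finset.Ico (j + 1) (m + 1), ∑ s ∈ Finset.range (n + 1),
            c s t * (z ^ (k - i - n + s) * w ^ (l - j + t) / p)
      = z ^ (k - i - n) * w ^ (l - j) / p *
        ∑ t ∈ Finset.Ico (j + 1) (m + 1), auxCol n c t z * w ^ t := by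
    simp only [auxCol, Finset.mul_sum, Finset.sum_mul]
    apply Finset.sum_congr rfl; intro t _
    apply Finset.sum_congr rfl; intro s _
    rw [zpow_add₀ hz0 _ (s : ℤ), zpow_add₀ hw0 _ (t : ℤ), zpow_natCast, zpow_natCast]
    ring
  have e2 : ∑ t ∈ Finset.range (j + 1), ∑ s ∈ Finset.range (n + 1), reflC n m c s t *
            (z ^ (k - i - 2 * n + s) * w ^ (l - j + t - m) / star p)
      = z ^ (k - i - 2 * n) * w ^ (l - j - m) / star p *
        ∑ t ∈ Finset.range (j + 1), auxCol n (reflC n m c) t z * w ^ t := by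
    simp only [auxCol, Finset.mul_sum, Finset.sum_mul]
    apply Finset.sum_congr rfl; intro t _
    apply Finset.sum_congr rfl; intro s _
    rw [show l - j + t - m = l - j - m + (t : ℤ) by ring,
      zpow_add₀ hz0 _ (s : ℤ), zpow_add₀ hw0 _ (t : ℤ), zpow_natCast, zpow_natCast]
    ring
  rw [e1, e2]
  generalize (∑ t ∈ Finset.Ico (j + 1) (m + 1), auxCol n c t z * w ^ t) = X
  generalize (∑ t ∈ Finset.range (j + 1), auxCol n (reflC n m c) t z * w ^ t) = Y
  have f1 : z ^ (k - i - 2 * n) = z ^ (k - i - n) * z ^ (-(n : ℤ)) := by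
    rw [← zpow_add₀ hz0]; congr 1; ring
  have f2 : w ^ (l - j - m) = w ^ (l - j) * w ^ (-(m : ℤ)) := by
    rw [← zpow_add₀ hw0]; congr 1
  have f3 : z ^ (k - i - n) = z ^ k * z ^ (-(i : ℤ) - n) := by
    rw [← zpow_add₀ hz0]; congr 1; ring
  have f4 : w ^ (l - j) = w ^ l * w ^ (-(j : ℤ)) := by
    rw [← zpow_add₀ hw0]; congr 1
  rw [f1, f2, f3, f4]
  generalize z ^ k = u1
  generalize z ^ (-(i : ℤ) - n) = u2
  generalize z ^ (-(n : ℤ)) = u3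
  generalize w ^ (-(m : ℤ)) = u4
  generalize w ^ (-(j : ℤ)) = u5
  generalize w ^ l = u6
  generalize star p = q at *
  field_simp

lemma aux_intbl (F : ℝ × ℝ → ℂ) (hF : Continuous F) : IntegrableOn F auxS :=
  hF.continuousOn.integrableOn_compact aux_compact

lemma aux_quot_cont' {n m : ℕ} {c : ℕ → ℕ → ℂ} (h : Stable n m c) (k l : ℤ) :
    Continuous fun x : ℝ × ℝ => tmono k l x.1 x.2 / star (onT n m c x.1 x.2) :=
  (aux_tmono_cont k l).div (aux_onT_cont n m c).star fun x => by
    simpa using aux_onT_ne h _ _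

lemma aux_key {n m : ℕ} {c : ℕ → ℕ → ℂ} (hs : Stable n m c)
    {a : ℕ → ℕ → ℕ → ℂ} (ha : IsLCoeff n m c a) (i j : ℕ) (hj : j < m) (k l : ℤ)
    (hl : 0 ≤ l) (hkl : l < m ∨ k < n) :
    ∫ x in auxS, tmono k l x.1 x.2 *
        star (tmono (i : ℤ) 0 x.1 x.2 * onT (2 * n) (m - 1) (a j) x.1 x.2) /
        ((Complex.normSq (onT n m c x.1 x.2) : ℝ) : ℂ)
      = ∫ x in auxS, tmono (k - i - n) (l - j) x.1 x.2 := by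
  simp only [aux_point hs ha i j hj k l]
  have c1 : ∀ t s : ℕ, Continuous fun x : ℝ × ℝ =>
      c s t * (tmono (k - i - n + s) (l - j + t) x.1 x.2 / onT n m c x.1 x.2) := fun t s =>
    continuous_const.mul (aux_quot_cont hs _ _)
  have c2 : ∀ t s : ℕ, Continuous fun x : ℝ × ℝ => reflC n m c s t *
      (tmono (k - i - 2 * n + s) (l - j + t - m) x.1 x.2 / star (onT n m c x.1 x.2)) := fun t s =>
    continuous_const.mul (aux_quot_cont' hs _ _)
  have d1 : Continuous fun x : ℝ × ℝ => ∑ t ∈ Finset.Ico (j + 1) (m + 1),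
      ∑ s ∈ Finset.range (n + 1),
      c s t * (tmono (k - i - n + s) (l - j + t) x.1 x.2 / onT n m c x.1 x.2) :=
    continuous_finsetSum _ fun t _ => continuous_finsetSum _ fun s _ => c1 t s
  have d2 : Continuous fun x : ℝ × ℝ => ∑ t ∈ Finset.range (j + 1), ∑ s ∈ Finset.range (n + 1),
      reflC n m c s t *
      (tmono (k - i - 2 * n + s) (l - j + t - m) x.1 x.2 / star (onT n m c x.1 x.2)) :=
    continuous_finsetSum _ fun t _ => continuous_finsetSum _ fun s _ => c2 t s
  have d3 := (aux_tmono_cont (k - i - n) (l - j)).fun_sub d1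
  rw [integral_sub (aux_intbl _ d3) (aux_intbl _ d2),
    integral_sub (aux_intbl _ (aux_tmono_cont _ _)) (aux_intbl _ d1)]
  rw [integral_finsetSum _ fun t _ => aux_intbl _ (continuous_finsetSum _ fun s _ => c1 t s),
    integral_finsetSum _ fun t _ => aux_intbl _ (continuous_finsetSum _ fun s _ => c2 t s)]
  rw [Finset.sum_eq_zero, Finset.sum_eq_zero, sub_zero, sub_zero]
  · intro t ht
    rw [integral_finsetSum _ fun s _ => aux_intbl _ (c2 t s)]
    apply Finset.sum_eq_zero
    intro s hs'
    simp only [Finset.mem_range] at ht hs'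
    rw [integral_const_mul, aux_int_conj hs, mul_zero]
    rcases hkl with h | h
    · right; omega
    · left; omega
  · intro t ht
    rw [integral_finsetSum _ fun s _ => aux_intbl _ (c1 t s)]
    apply Finset.sum_eq_zero
    intro s _
    simp only [Finset.mem_Ico] at ht
    rw [integral_const_mul, aux_int_w hs, mul_zero]
    omega

lemma aux_dens_cont {n m : ℕ} {c : ℕ → ℕ → ℂ} (h : Stable n m c) :
    Continuous fun x : ℝ × ℝ => 1 / ((2 * Real.pi) ^ 2 * Complex.normSq (onT n m c x.1 x.2)) := by
  apply continuous_const.div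
  · exact continuous_const.mul (Complex.continuous_normSq.comp (aux_onT_cont n m c))
  · intro x
    have := Complex.normSq_pos.mpr (aux_onT_ne h x.1 x.2)
    positivity

lemma aux_finite {n m : ℕ} {c : ℕ → ℕ → ℂ} (h : Stable n m c) : IsFiniteMeasure (muT n m c) := by
  unfold muT
  apply isFiniteMeasure_withDensity_ofReal
  exact ((aux_dens_cont h).continuousOn.integrableOn_compact aux_compact).2

lemma aux_integral {n m : ℕ} {c : ℕ → ℕ → ℂ} (h : Stable n m c) (F : ℝ × ℝ → ℂ) :
    ∫ x, F x ∂(muT n m c) = (1 / (2 * Real.pi) ^ 2 : ℂ) *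
      ∫ x in auxS, F x / ((Complex.normSq (onT n m c x.1 x.2) : ℝ) : ℂ) := by
  unfold muT
  rw [integral_withDensity_eq_integral_toReal_smul
    (aux_dens_cont h).measurable.ennreal_ofReal (by simp), ← integral_const_mul]
  unfold auxS
  congr 1
  funext x
  have := Complex.normSq_nonneg (onT n m c x.1 x.2)
  rw [ENNReal.toReal_ofReal (by positivity), Complex.real_smul]
  push_cast
  rw [one_div, mul_inv]
  ring

lemma aux_inner {n m : ℕ} {c : ℕ → ℕ → ℂ} (h : Stable n m c) (f g : Lp ℂ 2 (muT n m c))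
    (F G : ℝ × ℝ → ℂ) (hf : f =ᵐ[muT n m c] F) (hg : g =ᵐ[muT n m c] G) :
    ⟪f, g⟫ = (1 / (2 * Real.pi) ^ 2 : ℂ) *
      ∫ x in auxS, G x * star (F x) / ((Complex.normSq (onT n m c x.1 x.2) : ℝ) : ℂ) := by
  rw [L2.inner_def, ← aux_integral h fun x => G x * star (F x)]
  apply integral_congr_ae
  filter_upwards [hf, hg] with x h1 h2
  rw [h1, h2, RCLike.inner_apply]; rfl

/-- The class of a bounded multiple. -/
lemma aux_memLp {n m : ℕ} {c : ℕ → ℕ → ℂ} (f : Lp ℂ 2 (muT n m c)) :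
    MemLp (fun x : ℝ × ℝ => ((Complex.normSq (onT n m c x.1 x.2) : ℝ) : ℂ) * f x) 2
      (muT n m c) := by
  have hc : Continuous fun x : ℝ × ℝ => ((Complex.normSq (onT n m c x.1 x.2) : ℝ) : ℂ) :=
    Complex.continuous_ofReal.comp (Complex.continuous_normSq.comp (aux_onT_cont n m c))
  obtain ⟨C, hC⟩ := (aux_compact.image hc).isBounded.exists_norm_le
  refine MemLp.of_le_mul (c := C) (Lp.memLp f)
    (hc.aestronglyMeasurable.mul (Lp.aestronglyMeasurable f)) ?_
  have : ∀ᵐ x ∂(muT n m c), x ∈ auxS := by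
    unfold muT
    exact (withDensity_absolutelyContinuous _ _).ae_le (ae_restrict_mem aux_meas)
  filter_upwards [this] with x hx
  rw [norm_mul]
  gcongr
  exact hC _ ⟨x, hx, rfl⟩

/-- Multiplication by `|p|²`. -/
noncomputable def auxMul {n m : ℕ} {c : ℕ → ℕ → ℂ} (f : Lp ℂ 2 (muT n m c)) : Lp ℂ 2 (muT n m c) :=
  (aux_memLp f).toLp _

lemma auxMul_coe {n m : ℕ} {c : ℕ → ℕ → ℂ} (f : Lp ℂ 2 (muT n m c)) :
    auxMul f =ᵐ[muT n m c] fun x => ((Complex.normSq (onT n m c x.1 x.2) : ℝ) : ℂ) * f x :=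
  MemLp.coeFn_toLp _

lemma auxMul_symm {n m : ℕ} {c : ℕ → ℕ → ℂ} (f g : Lp ℂ 2 (muT n m c)) :
    ⟪auxMul f, g⟫ = ⟪f, auxMul g⟫ := by
  rw [L2.inner_def, L2.inner_def]
  apply integral_congr_ae
  filter_upwards [auxMul_coe f, auxMul_coe g] with x h1 h2
  rw [h1, h2, RCLike.inner_apply, RCLike.inner_apply, map_mul]
  simp only [Complex.conj_ofReal]
  ring

lemma auxMul_zero {n m : ℕ} {c : ℕ → ℕ → ℂ} (h : Stable n m c) (f : Lp ℂ 2 (muT n m c))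
    (hf : ⟪f, auxMul f⟫ = 0) : f = 0 := by
  have hi := L2.integrable_inner (𝕜 := ℂ) f (auxMul f)
  have he : (fun x => inner ℂ (f x) (auxMul f x)) =ᵐ[muT n m c]
      fun x => ((Complex.normSq (onT n m c x.1 x.2) * ‖f x‖ ^ 2 : ℝ) : ℂ) := by
    filter_upwards [auxMul_coe f] with x h1
    rw [h1, RCLike.inner_apply, mul_assoc, Complex.mul_conj, Complex.normSq_eq_norm_sq (f x)]
    push_cast; ring
  rw [L2.inner_def, integral_congr_ae he, integral_complex_ofReal, Complex.ofReal_eq_zero] at hf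
  have hi2 := (hi.congr he).re
  simp only [RCLike.re_to_complex, Complex.ofReal_re] at hi2
  rw [integral_eq_zero_iff_of_nonneg (fun x => by
    have := Complex.normSq_nonneg (onT n m c x.1 x.2); dsimp; positivity) hi2] at hf
  apply Lp.ext
  filter_upwards [hf, Lp.coeFn_zero ℂ 2 (muT n m c)] with x hx h0
  rw [h0]
  have := (Complex.normSq_pos.mpr (aux_onT_ne h x.1 x.2)).ne'
  simpa [aux_onT_ne h x.1 x.2] using hx

lemma aux_orth_closure {E : Type*} [NormedAddCommGroup E] [InnerProductSpace ℂ E] (S : Set E) (v : E)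
    (h : ∀ s ∈ S, ⟪v, s⟫ = 0) :
    ∀ f ∈ (Submodule.span ℂ S).topologicalClosure, ⟪v, f⟫ = 0 := by
  have : (Submodule.span ℂ S).topologicalClosure ≤ (Submodule.span ℂ {v})ᗮ := by
    apply Submodule.topologicalClosure_minimal _ _ (Submodule.isClosed_orthogonal _)
    rw [Submodule.span_le]
    intro s hs
    rw [SetLike.mem_coe, Submodule.mem_orthogonal_singleton_iff_inner_right]
    exact h s hs
  intro f hf
  exact (Submodule.mem_orthogonal_singleton_iff_inner_right).mp (this hf)

lemma aux_evalP_tmono (n m : ℕ) (c : ℕ → ℕ → ℂ) (i : ℕ) (θ φ : ℝ) :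
    tmono (i : ℤ) 0 θ φ * onT n m c θ φ = ∑ s ∈ Finset.range (n + 1),
      ∑ t ∈ Finset.range (m + 1), c s t * tmono ((i + s : ℕ) : ℤ) (t : ℤ) θ φ := by
  unfold onT evalP
  simp only [aux_tmono_eq, Finset.mul_sum, zpow_natCast, zpow_zero, mul_one, pow_add]
  apply Finset.sum_congr rfl; intro s _
  apply Finset.sum_congr rfl; intro t _
  ring

/-- the closed span of {z^i a_j : i ≥ 0, 0 ≤ j < m} equals the orthogonal
complement of span{z^i w^j : 0 ≤ i < n, 0 ≤ j < m} inside the closed span of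
{z^i w^j : i ≥ 0, 0 ≤ j < m}, and this space is orthogonal to the closed span of
{z^i w^j : i < n, j ≥ 0}. -/
theorem statement11 (n m : ℕ) (c : ℕ → ℕ → ℂ)
    (hstable : Stable n m c) (hdeg : DegreeNM n m c)
    (a : ℕ → ℕ → ℕ → ℂ) (ha : IsLCoeff n m c a)
    (M : ℤ → ℤ → Lp ℂ 2 (muT n m c))
    (hM : ∀ i j : ℤ, (M i j : ℝ × ℝ → ℂ) =ᵐ[muT n m c] fun x => tmono i j x.1 x.2)
    (ZA : ℕ → ℕ → Lp ℂ 2 (muT n m c))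
    (hZA : ∀ (i k : ℕ), k < m → (ZA i k : ℝ × ℝ → ℂ) =ᵐ[muT n m c]
      fun x => tmono (i : ℤ) 0 x.1 x.2 * onT (2 * n) (m - 1) (a k) x.1 x.2) :
    (Submodule.span ℂ {f | ∃ i k : ℕ, k < m ∧ f = ZA i k}).topologicalClosure
      = (Submodule.span ℂ
            {f | ∃ i j : ℕ, j < m ∧ f = M (i : ℤ) (j : ℤ)}).topologicalClosure
        ⊓ (Submodule.span ℂ
            {f | ∃ i j : ℕ, i < n ∧ j < m ∧ f = M (i : ℤ) (j : ℤ)})ᗮ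
    ∧ ∀ f ∈ (Submodule.span ℂ {f | ∃ i k : ℕ, k < m ∧ f = ZA i k}).topologicalClosure,
      ∀ g ∈ (Submodule.span ℂ
          {g | ∃ i j : ℤ, i < (n : ℤ) ∧ 0 ≤ j ∧ g = M i j}).topologicalClosure,
        ⟪f, g⟫ = 0 := by
  have hT : ∀ i j k l : ℤ, ⟪auxMul (M i j), M k l⟫ = (1 / (2 * Real.pi) ^ 2 : ℂ) *
      ∫ x in auxS, tmono (k - i) (l - j) x.1 x.2 := by
    intro i j k l
    have hf : auxMul (M i j) =ᵐ[muT n m c] fun x =>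
        ((Complex.normSq (onT n m c x.1 x.2) : ℝ) : ℂ) * tmono i j x.1 x.2 := by
      filter_upwards [auxMul_coe (M i j), hM i j] with x h1 h2
      rw [h1, h2]
    rw [aux_inner hstable _ _ _ _ hf (hM k l)]
    congr 2
    funext x
    have := aux_onT_ne hstable x.1 x.2
    have h0 : ((Complex.normSq (onT n m c x.1 x.2) : ℝ) : ℂ) ≠ 0 := by simpa using this
    rw [star_mul', aux_tmono_star, Complex.star_def, Complex.conj_ofReal, mul_left_comm,
      mul_div_cancel_left₀ _ h0, aux_tmono_mul]
    rfl
  have hL1 : ∀ (i j : ℕ) (k l : ℤ), j < m → 0 ≤ l → (l < m ∨ k < n) →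
      ⟪ZA i j, M k l⟫ = ⟪auxMul (M ((n + i : ℕ) : ℤ) (j : ℤ)), M k l⟫ := by
    intro i j k l hj hl hkl
    rw [hT, aux_inner hstable _ _ _ _ (hZA i j hj) (hM k l),
      aux_key hstable ha i j hj k l hl hkl]
    congr 4
    push_cast
    ring_nf
  have hL2 : ∀ i j k l : ℤ, ⟪auxMul (M i j), M k l⟫ = if k = i ∧ l = j then 1 else 0 := by
    intro i j k l
    rw [hT, aux_int_mono]
    simp only [sub_eq_zero]
    split_ifs
    · have : (Real.pi : ℂ) ≠ 0 := by exact_mod_cast Real.pi_ne_zero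
      field_simp
    · simp
  have hL2' : ∀ (i j : ℕ) (k l : ℤ), j < m → 0 ≤ l → k < n → ⟪ZA i j, M k l⟫ = 0 := by
    intro i j k l hj hl hk
    rw [hL1 i j k l hj hl (Or.inr hk), hL2, if_neg]
    push_cast
    omega
  set K := (Submodule.span ℂ {f | ∃ i k : ℕ, k < m ∧ f = ZA i k}).topologicalClosure with hK
  set H := (Submodule.span ℂ {f | ∃ i j : ℕ, j < m ∧ f = M (i : ℤ) (j : ℤ)}).topologicalClosure
    with hH
  set W := Submodule.span ℂ {f | ∃ i j : ℕ, i < n ∧ j < m ∧ f = M (i : ℤ) (j : ℤ)} with hW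
  have hMH : ∀ i j : ℕ, j < m → M (i : ℤ) (j : ℤ) ∈ H := fun i j hj =>
    Submodule.le_topologicalClosure _ (Submodule.subset_span ⟨i, j, hj, rfl⟩)
  -- second claim
  have hsecond : ∀ f ∈ K, ∀ g ∈ (Submodule.span ℂ
          {g | ∃ i j : ℤ, i < (n : ℤ) ∧ 0 ≤ j ∧ g = M i j}).topologicalClosure,
        ⟪f, g⟫ = 0 := by
    intro f hf g hg
    rw [inner_eq_zero_symm]
    refine aux_orth_closure _ g ?_ f hf
    rintro _ ⟨i, k, hk, rfl⟩
    rw [inner_eq_zero_symm]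
    refine aux_orth_closure _ _ ?_ g hg
    rintro _ ⟨k', l', hk', hl', rfl⟩
    exact hL2' i k k' l' hk hl' hk'
  refine ⟨?_, hsecond⟩
  have hKH : K ≤ H := by
    apply Submodule.topologicalClosure_minimal _ _ (Submodule.isClosed_topologicalClosure _)
    rw [Submodule.span_le]
    rintro _ ⟨i, k, hk, rfl⟩
    have hsum : ZA i k = ∑ s ∈ Finset.range (2 * n + 1), ∑ t ∈ Finset.range (m - 1 + 1),
        a k s t • M ((i + s : ℕ) : ℤ) (t : ℤ) := by
      apply Lp.ext
      have hall : ∀ᵐ x ∂(muT n m c), ∀ i j : ℤ, M i j x = tmono i j x.1 x.2 := by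
        rw [ae_all_iff]; intro i; rw [ae_all_iff]; intro j; exact hM i j
      have hsm : ∀ᵐ x ∂(muT n m c), ∀ s t : ℕ, (a k s t • M ((i + s : ℕ) : ℤ) (t : ℤ) :
          Lp ℂ 2 (muT n m c)) x = a k s t * M ((i + s : ℕ) : ℤ) (t : ℤ) x := by
        rw [ae_all_iff]; intro s; rw [ae_all_iff]; intro t; exact Lp.coeFn_smul _ _
      have hs1 : ∀ᵐ x ∂(muT n m c), ∀ s : ℕ, (∑ t ∈ Finset.range (m - 1 + 1),
          a k s t • M ((i + s : ℕ) : ℤ) (t : ℤ) : Lp ℂ 2 (muT n m c)) x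
          = ∑ t ∈ Finset.range (m - 1 + 1), (a k s t • M ((i + s : ℕ) : ℤ) (t : ℤ) :
            Lp ℂ 2 (muT n m c)) x := by
        rw [ae_all_iff]; intro s; exact Lp.coeFn_fun_finsetSum _ _
      filter_upwards [hall, hsm, hs1, hZA i k hk, Lp.coeFn_fun_finsetSum
        (Finset.range (2 * n + 1)) (fun s => (∑ t ∈ Finset.range (m - 1 + 1),
        a k s t • M ((i + s : ℕ) : ℤ) (t : ℤ) : Lp ℂ 2 (muT n m c)))] with x h1 h2 h3 h4 h5
      rw [h4, h5, aux_evalP_tmono]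
      simp only [h3, h2, h1]
    rw [hsum]
    refine Submodule.sum_mem _ fun s _ => Submodule.sum_mem _ fun t ht =>
      Submodule.smul_mem _ _ (hMH (i + s) t ?_)
    simp only [Finset.mem_range] at ht
    omega
  have hKW : K ≤ Wᗮ := by
    intro f hf
    rw [Submodule.mem_orthogonal']
    intro u hu
    apply hsecond f hf u
    apply Submodule.le_topologicalClosure
    refine Submodule.span_mono ?_ hu
    rintro _ ⟨i, j, hi, hj, rfl⟩
    exact ⟨i, j, by omega, by omega, rfl⟩
  apply le_antisymm (le_inf hKH hKW)
  rintro v ⟨hvH, hvW⟩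
  have hKc : IsClosed (K : Set (Lp ℂ 2 (muT n m c))) := Submodule.isClosed_topologicalClosure _
  have : CompleteSpace K := hKc.completeSpace_coe
  obtain ⟨k, hk, f, hf, rfl⟩ := K.exists_add_mem_mem_orthogonal v
  have hfH : f ∈ H := by simpa using H.sub_mem hvH (hKH hk)
  have hfW : f ∈ Wᗮ := by simpa using Wᗮ.sub_mem hvW (hKW hk)
  suffices hf0 : f = 0 by simpa [hf0] using hk
  -- Fourier coefficients of f beyond n vanish
  have hfour : ∀ i j : ℕ, j < m → ⟪auxMul (M ((n + i : ℕ) : ℤ) (j : ℤ)), f⟫ = 0 := by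
    intro i j hj
    have h1 : ⟪ZA i j - auxMul (M ((n + i : ℕ) : ℤ) (j : ℤ)), f⟫ = 0 := by
      refine aux_orth_closure _ _ ?_ f hfH
      rintro _ ⟨k', l', hl', rfl⟩
      rw [inner_sub_left, hL1 i j k' l' hj (by omega) (Or.inl (by omega)), sub_self]
    have h2 : ⟪ZA i j, f⟫ = 0 :=
      (Submodule.mem_orthogonal _ _).mp hf _ (Submodule.le_topologicalClosure _
        (Submodule.subset_span ⟨i, j, hj, rfl⟩))
    rw [inner_sub_left, h2, zero_sub, neg_eq_zero] at h1
    exact h1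
  set u := ∑ i ∈ Finset.range n, ∑ j ∈ Finset.range m,
    ⟪auxMul (M (i : ℤ) (j : ℤ)), f⟫ • M (i : ℤ) (j : ℤ) with hu
  have huW : u ∈ W := by
    refine Submodule.sum_mem _ fun i hi => Submodule.sum_mem _ fun j hj =>
      Submodule.smul_mem _ _ (Submodule.subset_span ⟨i, j, ?_, ?_, rfl⟩)
    · simpa using hi
    · simpa using hj
  have huH : u ∈ H := by
    refine Submodule.sum_mem _ fun i hi => Submodule.sum_mem _ fun j hj =>
      Submodule.smul_mem _ _ (hMH i j ?_)
    simpa using hj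
  have hgH : f - u ∈ H := H.sub_mem hfH huH
  have hg : ∀ k l : ℕ, l < m → ⟪auxMul (M (k : ℤ) (l : ℤ)), f - u⟫ = 0 := by
    intro k l hl
    rw [inner_sub_right, hu, inner_sum]
    simp only [inner_sum, inner_smul_right, hL2]
    by_cases hk : k < n
    · rw [Finset.sum_eq_single k, Finset.sum_eq_single l]
      · simp
      · intro j _ hj
        rw [if_neg (by omega), mul_zero]
      · intro h; simp at h; omega
      · intro i _ hi
        apply Finset.sum_eq_zero
        intro j _
        rw [if_neg (by omega), mul_zero]
      · intro h; simp at h; omega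
    · obtain ⟨d, rfl⟩ := Nat.exists_eq_add_of_le (not_lt.mp hk)
      rw [hfour d l hl, Finset.sum_eq_zero, sub_zero]
      intro i hi
      apply Finset.sum_eq_zero
      intro j _
      simp only [Finset.mem_range] at hi
      rw [if_neg (by omega), mul_zero]
  have hzero : f - u = 0 := by
    apply auxMul_zero hstable
    rw [inner_eq_zero_symm]
    refine aux_orth_closure _ _ ?_ _ hgH
    rintro _ ⟨k', l', hl', rfl⟩
    rw [inner_eq_zero_symm, ← auxMul_symm]
    exact hg k' l' hl'
  have hfu : f = u := sub_eq_zero.mp hzero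
  have : ⟪f, f⟫ = 0 := (Submodule.mem_orthogonal _ _).mp hfW f (hfu ▸ huW)
  exact inner_self_eq_zero.mp this
end
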